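/- Kisielewski's lemma: Let k ≥ 2 be an integer, let c(z) ∈ ℂ(z) be a nonzero rational function, and let α ∈ ℂ \ {0}. Then there exists r ∈ {0, …, k−1} such that ν_α(Λ_r(c)(z^k)) ≤ ν_α(c(z)), where Λ_r(c) is the rational function obtained by applying the Cartier operator Λ_r to the Laurent expansion of c at z = 0, and Λ_r(c)(z^k) is its composition with z^k. -/

import Mathlib

open Polynomial

/-- Order of vanishing at `α` of a rational function (negative at a pole). -/
noncomputable def nuRat (α : ℂ) (c : RatFunc ℂ) : ℤ :=
  (c.num.rootMultiplicity α : ℤ) - (c.denom.rootMultiplicity α : ℤ)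

/-- Substitution `z ↦ z^m` on rational functions. -/
noncomputable def ratSubst (m : ℕ) (c : RatFunc ℂ) : RatFunc ℂ :=
  algebraMap (Polynomial ℂ) (RatFunc ℂ) (c.num.comp (X ^ m)) /
    algebraMap (Polynomial ℂ) (RatFunc ℂ) (c.denom.comp (X ^ m))

/-- Every polynomial splits according to the residues of its exponents modulo `k`. -/
theorem exists_eq_sum_X_pow_mul_expand {R : Type*} [CommSemiring R] {k : ℕ} (hk : 0 < k)
    (p : R[X]) :
    ∃ f : ℕ → R[X], p = ∑ i ∈ Finset.range k, X ^ i * expand R k (f i) := by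
  induction p using Polynomial.induction_on' with
  | add p q hp hq =>
    obtain ⟨f, hf⟩ := hp
    obtain ⟨g, hg⟩ := hq
    refine ⟨f + g, ?_⟩
    simp only [Pi.add_apply, map_add, mul_add, Finset.sum_add_distrib, ← hf, ← hg]
  | monomial n a =>
    refine ⟨Pi.single (n % k) (monomial (n / k) a), ?_⟩
    rw [Finset.sum_eq_single_of_mem (n % k) (Finset.mem_range.2 (Nat.mod_lt n hk))]
    · rw [Pi.single_eq_same, expand_monomial, X_pow_mul_monomial, Nat.div_add_mod']
    · intro i _ hi
      rw [Pi.single_eq_of_ne hi, map_zero, mul_zero]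

theorem exists_dvd_expand {K : Type*} [Field K] [IsAlgClosed K] (k : ℕ) {q : K[X]}
    (hq : q ≠ 0) : ∃ s : K[X], s ≠ 0 ∧ q ∣ expand K k s := by
  refine ⟨C q.leadingCoeff * (q.roots.map fun a => X - C (a ^ k)).prod, ?_, ?_⟩
  · refine mul_ne_zero (by simpa using hq) (Multiset.prod_ne_zero ?_)
    rw [Multiset.mem_map]
    rintro ⟨a, _, ha⟩
    exact X_sub_C_ne_zero (a ^ k) ha
  · conv_lhs => rw [(IsAlgClosed.splits q).eq_prod_roots]
    rw [map_mul, expand_C, map_multiset_prod, Multiset.map_map]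
    refine mul_dvd_mul_left _ (Multiset.prod_dvd_prod_of_dvd _ _ fun a _ => ?_)
    simpa using sub_dvd_pow_sub_pow (X : K[X]) (C a) k

theorem exists_rootMultiplicity_expand_le {R : Type*} [CommRing R] [IsDomain R] {k : ℕ}
    (hk : 0 < k) {p : R[X]} (hp : p ≠ 0) (f : ℕ → R[X])
    (hf : p = ∑ i ∈ Finset.range k, X ^ i * expand R k (f i)) (a : R) :
    ∃ i < k, f i ≠ 0 ∧ (expand R k (f i)).rootMultiplicity a ≤ p.rootMultiplicity a := by
  by_contra! h
  refine pow_rootMultiplicity_not_dvd hp a ?_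
  conv_rhs => rw [hf]
  refine Finset.dvd_sum fun i hi => Dvd.dvd.mul_left ?_ _
  by_cases h0 : f i = 0
  · simp [h0]
  · exact (le_rootMultiplicity_iff ((expand_ne_zero hk).2 h0)).1
      (h i (Finset.mem_range.1 hi) h0)

theorem nuRat_eq_sub {c : RatFunc ℂ} {p q : ℂ[X]} (hp : p ≠ 0)
    (h : c.num * q = p * c.denom) (α : ℂ) :
    nuRat α c = (p.rootMultiplicity α : ℤ) - (q.rootMultiplicity α : ℤ) := by
  have hne : p * c.denom ≠ 0 := mul_ne_zero hp c.denom_ne_zero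
  have hm := congrArg (rootMultiplicity α) h
  rw [rootMultiplicity_mul hne, rootMultiplicity_mul (h ▸ hne)] at hm
  unfold nuRat
  lia

theorem nuRat_div {p q : ℂ[X]} (hp : p ≠ 0) (hq : q ≠ 0) (α : ℂ) :
    nuRat α (algebraMap ℂ[X] (RatFunc ℂ) p / algebraMap ℂ[X] (RatFunc ℂ) q) =
      (p.rootMultiplicity α : ℤ) - (q.rootMultiplicity α : ℤ) :=
  nuRat_eq_sub hp ((RatFunc.num_mul_eq_mul_denom_iff hq).2 rfl) α

theorem ratSubst_div {k : ℕ} (hk : 0 < k) (p : ℂ[X]) {q : ℂ[X]} (hq : q ≠ 0) :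
    ratSubst k (algebraMap ℂ[X] (RatFunc ℂ) p / algebraMap ℂ[X] (RatFunc ℂ) q) =
      algebraMap ℂ[X] (RatFunc ℂ) (expand ℂ k p) /
        algebraMap ℂ[X] (RatFunc ℂ) (expand ℂ k q) := by
  have h := congrArg (expand ℂ k) ((RatFunc.num_mul_eq_mul_denom_iff (x :=
    algebraMap ℂ[X] (RatFunc ℂ) p / algebraMap ℂ[X] (RatFunc ℂ) q) hq).2 rfl)
  unfold ratSubst
  rw [← expand_eq_comp_X_pow, ← expand_eq_comp_X_pow, div_eq_div_iff
    (RatFunc.algebraMap_ne_zero ((expand_ne_zero hk).2 (RatFunc.denom_ne_zero _)))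
    (RatFunc.algebraMap_ne_zero ((expand_ne_zero hk).2 hq)), ← map_mul, ← map_mul, h,
    map_mul, map_mul]

/-- Substitution `z ↦ z ^ k` on Laurent series. -/
noncomputable def laurentExpand (R : Type*) [CommSemiring R] {k : ℕ} (hk : 0 < k) :
    LaurentSeries R →+* LaurentSeries R :=
  HahnSeries.embDomainRingHom (AddMonoidHom.mulLeft (k : ℤ))
    (mul_right_injective₀ (by exact_mod_cast hk.ne'))
    fun _ _ => mul_le_mul_iff_right₀ (by exact_mod_cast hk)

theorem coeff_laurentExpand_mul {R : Type*} [CommSemiring R] {k : ℕ} (hk : 0 < k)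
    (f : LaurentSeries R) (n : ℤ) : (laurentExpand R hk f).coeff (k * n) = f.coeff n :=
  HahnSeries.embDomain_coeff (a := n)

theorem coeff_laurentExpand_of_not_dvd {R : Type*} [CommSemiring R] {k : ℕ} (hk : 0 < k)
    (f : LaurentSeries R) {n : ℤ} (hn : ¬ (k : ℤ) ∣ n) :
    (laurentExpand R hk f).coeff n = 0 := by
  refine HahnSeries.embDomain_of_notMem_range ?_
  rintro ⟨m, rfl⟩
  exact hn (dvd_mul_right _ _)

theorem coeff_sum_single_mul_laurentExpand {R : Type*} [CommRing R] {k : ℕ} (hk : 0 < k)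
    (f : ℕ → LaurentSeries R) {r : ℕ} (hr : r < k) (n : ℤ) :
    (∑ i ∈ Finset.range k, HahnSeries.single (i : ℤ) (1 : R) * laurentExpand R hk (f i)).coeff
      (k * n + r) = (f r).coeff n := by
  rw [HahnSeries.coeff_sum, Finset.sum_eq_single_of_mem r (Finset.mem_range.2 hr)]
  · rw [HahnSeries.coeff_single_mul, add_sub_cancel_right, coeff_laurentExpand_mul, one_mul]
  · intro i hi hir
    rw [HahnSeries.coeff_single_mul, coeff_laurentExpand_of_not_dvd hk, mul_zero]
    rw [add_sub_assoc, dvd_add_right (dvd_mul_right _ _)]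
    intro hd
    have := Int.eq_zero_of_abs_lt_dvd hd
      (abs_lt.2 ⟨by have := Finset.mem_range.1 hi; lia, by lia⟩)
    lia

section

open scoped RatFunc

theorem algebraMap_X_pow_eq_single {K : Type*} [Field K] (n : ℕ) :
    algebraMap (RatFunc K) (LaurentSeries K) (algebraMap K[X] (RatFunc K) (X ^ n)) =
      HahnSeries.single (n : ℤ) 1 := by
  rw [map_pow, map_pow, RatFunc.algebraMap_X, RatFunc.coe_X, HahnSeries.single_pow, one_pow,
    nsmul_one]

theorem laurentExpand_algebraMap {K : Type*} [Field K] {k : ℕ} (hk : 0 < k) (p : K[X]) :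
    laurentExpand K hk (algebraMap (RatFunc K) (LaurentSeries K)
      (algebraMap K[X] (RatFunc K) p)) =
      algebraMap (RatFunc K) (LaurentSeries K) (algebraMap K[X] (RatFunc K) (expand K k p)) := by
  have h : ((laurentExpand K hk).comp ((algebraMap (RatFunc K) (LaurentSeries K)).comp
      (algebraMap K[X] (RatFunc K)))) = ((algebraMap (RatFunc K) (LaurentSeries K)).comp
      (algebraMap K[X] (RatFunc K))).comp (expand K k : K[X] →+* K[X]) := by
    refine Polynomial.ringHom_ext (fun a => ?_) ?_
    · have hC : algebraMap (RatFunc K) (LaurentSeries K) (algebraMap K[X] (RatFunc K) (C a)) =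
          HahnSeries.C a :=
        (RatFunc.coe_coe (C a)).symm.trans (by rw [Polynomial.coe_C, PowerSeries.coe_C])
      simp only [RingHom.comp_apply, RingHom.coe_coe, expand_C, hC]
      exact HahnSeries.embDomainRingHom_C
    · have hX := algebraMap_X_pow_eq_single (K := K) 1
      rw [pow_one] at hX
      simp only [RingHom.comp_apply, RingHom.coe_coe, expand_X]
      rw [hX, algebraMap_X_pow_eq_single]
      refine HahnSeries.embDomain_single.trans ?_
      simp
  exact RingHom.congr_fun h p

theorem coeff_algebraMap_div {K : Type*} [Field K] {k : ℕ} (hk : 0 < k) {p s : K[X]}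
    (f : ℕ → K[X])
    (hf : p = ∑ i ∈ Finset.range k, X ^ i * expand K k (f i)) {r : ℕ} (hr : r < k) (n : ℤ) :
    (algebraMap (RatFunc K) (LaurentSeries K)
      (algebraMap K[X] (RatFunc K) (f r) / algebraMap K[X] (RatFunc K) s)).coeff n =
    (algebraMap (RatFunc K) (LaurentSeries K) (algebraMap K[X] (RatFunc K) p /
      algebraMap K[X] (RatFunc K) (expand K k s))).coeff (k * n + r) := by
  rw [← coeff_sum_single_mul_laurentExpand hk (fun i => algebraMap (RatFunc K) (LaurentSeries K)
      (algebraMap K[X] (RatFunc K) (f i) / algebraMap K[X] (RatFunc K) s)) hr]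
  congr 1
  rw [hf, map_sum, Finset.sum_div, map_sum]
  refine Finset.sum_congr rfl fun i _ => ?_
  rw [map_div₀, map_div₀, map_div₀, laurentExpand_algebraMap, laurentExpand_algebraMap, map_mul,
    map_mul, algebraMap_X_pow_eq_single, mul_div_assoc]

end

/-- **Kisielewski's lemma.** For a nonzero rational function `c` and `α ≠ 0`, there is
some `r ∈ {0,…,k-1}` such that the Cartier image `Λ_r(c)` (computed on the Laurent
expansion of `c` at `0`) is a (nonzero) rational function `d` with
`ν_α(d(z^k)) ≤ ν_α(c)`. -/
theorem kisielewski_lemma (k : ℕ) (hk : 2 ≤ k) (c : RatFunc ℂ) (hc : c ≠ 0)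
    (α : ℂ) (hα : α ≠ 0) :
    ∃ r : ℕ, r < k ∧ ∃ d : RatFunc ℂ, d ≠ 0 ∧
      (∀ n : ℤ, (d : LaurentSeries ℂ).coeff n =
        (c : LaurentSeries ℂ).coeff ((k : ℤ) * n + (r : ℤ))) ∧
      nuRat α (ratSubst k d) ≤ nuRat α c := by
  have hk0 : 0 < k := by lia
  obtain ⟨s, hs, t, ht⟩ := exists_dvd_expand k c.denom_ne_zero
  have hes : expand ℂ k s ≠ 0 := (expand_ne_zero hk0).2 hs
  have ht0 : t ≠ 0 := by
    rintro rfl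
    exact hes (by rw [ht, mul_zero])
  have hp : c.num * t ≠ 0 := mul_ne_zero (RatFunc.num_ne_zero hc) ht0
  have hcross : c.num * expand ℂ k s = c.num * t * c.denom := by
    rw [ht]
    ring
  have hcdiv := (RatFunc.num_mul_eq_mul_denom_iff hes).1 hcross
  obtain ⟨f, hf⟩ := exists_eq_sum_X_pow_mul_expand hk0 (c.num * t)
  obtain ⟨r, hr, hfr, hle⟩ := exists_rootMultiplicity_expand_le hk0 hp f hf α
  refine ⟨r, hr, algebraMap ℂ[X] (RatFunc ℂ) (f r) / algebraMap ℂ[X] (RatFunc ℂ) s,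
    div_ne_zero (RatFunc.algebraMap_ne_zero hfr) (RatFunc.algebraMap_ne_zero hs), fun n => ?_, ?_⟩
  · conv_rhs => rw [hcdiv]
    exact coeff_algebraMap_div hk0 f hf hr n
  · rw [ratSubst_div hk0 _ hs, nuRat_div ((expand_ne_zero hk0).2 hfr) hes,
      nuRat_eq_sub hp hcross]
    lia
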